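/- For every d×d unitary matrix U and every ε > 0 there exists a d×d unitary matrix T with ‖T - 1‖ < ε such that all minors of the product T·U are nonzero. -/

import Mathlib

/-- All minors of a square matrix are nonzero: for every `1 ≤ k ≤ d` and every pair of
injections `σ τ : Fin k → Fin d`, the determinant of the corresponding `k × k`
submatrix is nonzero. -/
def AllMinorsNonzero {d : ℕ} (V : Matrix (Fin d) (Fin d) ℂ) : Prop :=
  ∀ k : ℕ, 1 ≤ k → k ≤ d → ∀ σ τ : Fin k → Fin d,
    Function.Injective σ → Function.Injective τ →
      (Matrix.of fun r s : Fin k => V (σ r) (τ s)).det ≠ 0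

open Filter Topology Polynomial in
theorem Polynomial.eventually_eval_ofReal_ne_zero {p : ℂ[X]} (hp : p ≠ 0) :
    ∀ᶠ t : ℝ in 𝓝[≠] 0, p.eval (t : ℂ) ≠ 0 := by
  have hfin : {t : ℝ | p.eval (t : ℂ) = 0}.Finite := by
    refine Set.Finite.preimage (Complex.ofReal_injective.injOn) (s := {z : ℂ | p.eval z = 0}) ?_
    exact (p.roots.toFinset.finite_toSet).subset fun z hz => by
      simpa [hp] using hz
  have h := (hfin.subset (Set.sdiff_subset (t := {0}))).isClosed.isOpen_compl.mem_nhds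
    (show (0 : ℝ) ∈ ({t : ℝ | p.eval (t : ℂ) = 0} \ {0})ᶜ by simp)
  filter_upwards [nhdsWithin_le_nhds h, self_mem_nhdsWithin] with t ht ht0 h0
  exact ht ⟨h0, ht0⟩

namespace Matrix

open Filter Topology Polynomial

variable {n : Type*} [Fintype n] [DecidableEq n]

/-- Every matrix has a rotation by a phase which does not have `-1` as an eigenvalue. -/
theorem exists_norm_eq_one_det_one_add_smul_ne_zero (M : Matrix n n ℂ) :
    ∃ c : ℂ, ‖c‖ = 1 ∧ (1 + c • M).det ≠ 0 := by
  set q : ℂ[X] := (1 + (X : ℂ[X]) • M.map C).det with hq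
  have heval (c : ℂ) : q.eval c = (1 + c • M).det := by
    rw [hq, ← coe_evalRingHom, RingHom.map_det]
    congr 1
    ext i j
    simp [Matrix.one_apply, apply_ite (eval c), mul_comm (M i j)]
  have hq0 : q ≠ 0 := fun h => by simpa [h] using heval 0
  have hinf : (Metric.sphere (0 : ℂ) 1).Infinite :=
    (isPreconnected_sphere (by simp) 0 1).infinite_of_nontrivial
      ⟨1, by simp, -1, by simp, by norm_num [Complex.ext_iff]⟩
  obtain ⟨c, hc, hcq⟩ := hinf.exists_notMem_finset q.roots.toFinset
  refine ⟨c, by simpa using hc, ?_⟩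
  rw [← heval]
  simpa [hq0] using hcq

/-- The Cayley-type curve `((1 - t) + (1 + t) M) ((1 + t) + (1 - t) M)⁻¹` through
`1` (at `t = 0`) and `M` (at `t = 1`). -/
noncomputable def cayleyCurve (M : Matrix n n ℂ) (t : ℂ) : Matrix n n ℂ :=
  ((1 - t) • 1 + (1 + t) • M) * ((1 + t) • 1 + (1 - t) • M)⁻¹

theorem cayleyCurve_one (M : Matrix n n ℂ) : cayleyCurve M 1 = M := by
  have h : ((2 : ℂ) • (1 : Matrix n n ℂ))⁻¹ = (2⁻¹ : ℂ) • 1 :=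
    inv_eq_right_inv (by simp [smul_smul])
  norm_num [cayleyCurve, h, smul_smul]

theorem cayleyCurve_mem_unitaryGroup {M : Matrix n n ℂ} (hM : M ∈ unitaryGroup n ℂ) (t : ℝ)
    (ht : (((1 : ℂ) + t) • 1 + ((1 : ℂ) - t) • M).det ≠ 0) :
    cayleyCurve M t ∈ unitaryGroup n ℂ := by
  set N := ((1 : ℂ) + t) • (1 : Matrix n n ℂ) + ((1 : ℂ) - t) • M with hN
  have hu : IsUnit N.det := isUnit_iff_ne_zero.2 ht
  have hMs : star M * M = 1 := mem_unitaryGroup_iff'.1 hM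
  have hMs' : M * star M = 1 := mem_unitaryGroup_iff.1 hM
  have hNs : star N = ((1 : ℂ) + t) • (1 : Matrix n n ℂ) + ((1 : ℂ) - t) • star M := by
    simp [hN, star_add, star_smul]
  have hL : ((1 : ℂ) - t) • (1 : Matrix n n ℂ) + ((1 : ℂ) + t) • M = M * star N := by
    rw [hNs, mul_add, mul_smul_comm, mul_smul_comm, hMs', mul_one, add_comm]
  have hcomm : N * star N = star N * N := by
    rw [hNs, hN]
    simp only [mul_add, add_mul, mul_smul_comm, smul_mul_assoc, hMs, hMs', one_mul, mul_one]
    module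
  rw [cayleyCurve, ← hN, hL, mem_unitaryGroup_iff']
  have h1 : N * N⁻¹ = 1 := mul_nonsing_inv _ hu
  have h2 : star N⁻¹ * star N = 1 := by rw [← star_mul, h1, star_one]
  calc star (M * star N * N⁻¹) * (M * star N * N⁻¹)
      = star N⁻¹ * (N * ((star M * M) * (star N * N⁻¹))) := by
        simp only [star_mul, star_star, mul_assoc]
    _ = star N⁻¹ * ((N * star N) * N⁻¹) := by rw [hMs, one_mul, mul_assoc]
    _ = (star N⁻¹ * star N) * (N * N⁻¹) := by rw [hcomm]; simp only [mul_assoc]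
    _ = 1 := by rw [h1, h2, one_mul]

theorem tendsto_cayleyCurve {M : Matrix n n ℂ} (hM : (1 + M).det ≠ 0) :
    Tendsto (fun t : ℝ => cayleyCurve M t) (𝓝 0) (𝓝 1) := by
  have hc : ContinuousAt (fun t : ℝ => cayleyCurve M t) 0 := by
    unfold cayleyCurve
    simp only [inv_def, Ring.inverse_eq_inv']
    refine ContinuousAt.mul (by fun_prop) (ContinuousAt.fun_smul (ContinuousAt.fun_inv₀ ?_ ?_) ?_)
    · fun_prop
    · simpa using hM
    · fun_prop
  have h0 : cayleyCurve M ((0 : ℝ) : ℂ) = 1 := by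
    simpa [cayleyCurve] using mul_nonsing_inv _ (isUnit_iff_ne_zero.2 hM)
  simpa only [ContinuousAt, h0] using hc

/-- If a minor of `M * V` is nonzero, then so is the same minor of `cayleyCurve M t * V`
for all small `t ≠ 0`. -/
theorem eventually_det_submatrix_cayleyCurve_mul_ne_zero {m : Type*} [Fintype m] [DecidableEq m]
    {M : Matrix n n ℂ} (hM : (1 + M).det ≠ 0) (V : Matrix n n ℂ) (σ τ : m → n)
    (h : ((M * V).submatrix σ τ).det ≠ 0) :
    ∀ᶠ t : ℝ in 𝓝[≠] 0, ((cayleyCurve M t * V).submatrix σ τ).det ≠ 0 := by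
  set P : Matrix n n ℂ[X] := ((1 - X : ℂ[X]) • 1 + (1 + X : ℂ[X]) • M.map C) *
    ((1 + X : ℂ[X]) • 1 + (1 - X : ℂ[X]) • M.map C).adjugate * V.map C with hP
  have hPe (t : ℂ) : P.map (evalRingHom t) = ((1 - t) • 1 + (1 + t) • M) *
      ((1 + t) • 1 + (1 - t) • M).adjugate * V := by
    have h1 (a b : ℂ[X]) : (a • (1 : Matrix n n ℂ[X]) + b • M.map C).map (evalRingHom t) =
        a.eval t • (1 : Matrix n n ℂ) + b.eval t • M := by
      ext i j
      simp [Matrix.one_apply, apply_ite (eval t)]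
    have h2 : (V.map C).map (evalRingHom t) = V := by ext; simp
    rw [hP, Matrix.map_mul, Matrix.map_mul, ← RingHom.mapMatrix_apply _ (adjugate _),
      RingHom.map_adjugate, RingHom.mapMatrix_apply, h1, h1, h2]
    simp
  set p : ℂ[X] := (P.submatrix σ τ).det with hp
  have hpe (t : ℂ) : ((cayleyCurve M t * V).submatrix σ τ).det =
      (((1 + t) • 1 + (1 - t) • M).det)⁻¹ ^ Fintype.card m * p.eval t := by
    rw [hp, ← coe_evalRingHom, RingHom.map_det, RingHom.mapMatrix_apply, ← submatrix_map, hPe,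
      cayleyCurve, inv_def, Ring.inverse_eq_inv', mul_smul_comm, smul_mul_assoc, ← det_smul]
    rfl
  have hp0 : p ≠ 0 := by
    intro h0
    have := hpe 1
    rw [cayleyCurve_one, h0, eval_zero, mul_zero] at this
    exact h this
  have hdet : ∀ᶠ t : ℝ in 𝓝 0, (((1 : ℂ) + t) • 1 + ((1 : ℂ) - t) • M).det ≠ 0 := by
    refine ContinuousAt.eventually_ne (by fun_prop) ?_
    simpa using hM
  filter_upwards [Polynomial.eventually_eval_ofReal_ne_zero hp0, nhdsWithin_le_nhds hdet]
    with t h1 h2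
  rw [hpe]
  exact mul_ne_zero (pow_ne_zero _ (inv_ne_zero h2)) h1

/-- Every minor is nonzero for some permutation matrix. -/
theorem exists_unitary_det_submatrix_ne_zero {k : ℕ} {σ τ : Fin k → n}
    (hσ : Function.Injective σ) (hτ : Function.Injective τ) :
    ∃ W ∈ unitaryGroup n ℂ, (W.submatrix σ τ).det ≠ 0 := by
  obtain ⟨g, hg⟩ := (Equiv.Perm.isMultiplyPretransitive n k).exists_smul_eq
    (⟨σ, hσ⟩ : Fin k ↪ n) ⟨τ, hτ⟩
  have hg' (r : Fin k) : g (σ r) = τ r := DFunLike.congr_fun hg r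
  refine ⟨(1 : Matrix n n ℂ).submatrix g id, ?_, ?_⟩
  · rw [mem_unitaryGroup_iff, star_eq_conjTranspose, conjTranspose_submatrix, conjTranspose_one,
      ← submatrix_mul _ _ _ _ _ Function.bijective_id]
    simp
  · have : ((1 : Matrix n n ℂ).submatrix g id).submatrix σ τ = 1 := by
      ext r s
      simp [hg', Matrix.one_apply, hτ.eq_iff]
    simp [this]

theorem dense_unitaryGroup_det_submatrix_ne_zero {k : ℕ} {σ τ : Fin k → n}
    (hσ : Function.Injective σ) (hτ : Function.Injective τ) :
    Dense {V : unitaryGroup n ℂ | ((V : Matrix n n ℂ).submatrix σ τ).det ≠ 0} := by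
  rintro ⟨V, hV⟩
  obtain ⟨W, hW, hWd⟩ := exists_unitary_det_submatrix_ne_zero hσ hτ
  obtain ⟨c, hc, hcd⟩ := exists_norm_eq_one_det_one_add_smul_ne_zero (W * star V)
  set M := c • (W * star V) with hMdef
  have hVs : star V * V = 1 := mem_unitaryGroup_iff'.1 hV
  have hcu : star c * c = 1 := by
    simpa [hc] using Complex.conj_mul' c
  have hM : M ∈ unitaryGroup n ℂ := by
    have h := mem_unitaryGroup_iff'.1 (mul_mem hW (Unitary.star_mem hV))
    rw [mem_unitaryGroup_iff', hMdef, star_smul, smul_mul_smul_comm, h, hcu, one_smul]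
  have hMV : ((M * V).submatrix σ τ).det ≠ 0 := by
    have h : (M * V).submatrix σ τ = c • W.submatrix σ τ := by
      rw [hMdef, smul_mul_assoc, mul_assoc, hVs, mul_one]
      rfl
    rw [h, det_smul]
    exact mul_ne_zero (pow_ne_zero _ (norm_ne_zero_iff.1 (by simp [hc]))) hWd
  have hdet : ∀ᶠ t : ℝ in 𝓝 0, (((1 : ℂ) + t) • 1 + ((1 : ℂ) - t) • M).det ≠ 0 := by
    refine ContinuousAt.eventually_ne (by fun_prop) ?_
    simpa using hcd
  rw [closure_subtype]
  have hlim : Tendsto (fun t : ℝ => cayleyCurve M t * V) (𝓝[≠] 0) (𝓝 V) := by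
    simpa using ((tendsto_cayleyCurve hcd).mul_const V).mono_left nhdsWithin_le_nhds
  refine mem_closure_of_tendsto hlim ?_
  filter_upwards [nhdsWithin_le_nhds hdet,
    eventually_det_submatrix_cayleyCurve_mul_ne_zero hcd V σ τ hMV] with t h1 h2
  exact ⟨⟨_, mul_mem (cayleyCurve_mem_unitaryGroup hM t h1) hV⟩, h2, rfl⟩

end Matrix

theorem dense_iInter_of_isOpen_of_finite {ι X : Type*} [Finite ι] [TopologicalSpace X]
    {s : ι → Set X} (ho : ∀ i, IsOpen (s i)) (hd : ∀ i, Dense (s i)) : Dense (⋂ i, s i) := by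
  classical
  have := Fintype.ofFinite ι
  have key (S : Finset ι) : Dense (⋂ i ∈ S, s i) := by
    induction S using Finset.induction_on with
    | empty => simp
    | insert a S _ ih =>
      rw [Finset.set_biInter_insert]
      exact (hd a).inter_of_isOpen_left ih (ho a)
  simpa using key Finset.univ

/-- For every `d × d` unitary matrix `U` and every `ε > 0` there is a
unitary matrix `T`, entrywise within `ε` of the identity, such that all minors of
`T * U` are nonzero. -/
theorem stmt_7 (d : ℕ) (hd : 1 ≤ d) (U : Matrix (Fin d) (Fin d) ℂ)
    (hU : U ∈ Matrix.unitaryGroup (Fin d) ℂ) (ε : ℝ) (hε : 0 < ε) :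
    ∃ T : Matrix (Fin d) (Fin d) ℂ, T ∈ Matrix.unitaryGroup (Fin d) ℂ ∧
      (∀ i j : Fin d, ‖(T - 1) i j‖ < ε) ∧ AllMinorsNonzero (T * U) := by
  have hUs : U * star U = 1 := Matrix.mem_unitaryGroup_iff.1 hU
  have hUs' : star U * U = 1 := Matrix.mem_unitaryGroup_iff'.1 hU
  have hdense := dense_iInter_of_isOpen_of_finite
    (ι := Σ k : Fin (d + 1), (Fin k ↪ Fin d) × (Fin k ↪ Fin d))
    (s := fun i => {V : Matrix.unitaryGroup (Fin d) ℂ |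
      ((V : Matrix (Fin d) (Fin d) ℂ).submatrix i.2.1 i.2.2).det ≠ 0})
    (fun i => isOpen_ne_fun (by fun_prop) (by fun_prop))
    (fun i => Matrix.dense_unitaryGroup_det_submatrix_ne_zero i.2.1.injective i.2.2.injective)
  have hopen : IsOpen {V : Matrix.unitaryGroup (Fin d) ℂ |
      ∀ i j, ‖((V : Matrix (Fin d) (Fin d) ℂ) * star U - 1) i j‖ < ε} := by
    simp only [Set.ofPred_forall]
    exact isOpen_iInter_of_finite fun i => isOpen_iInter_of_finite fun j =>
      isOpen_lt (by fun_prop) (by fun_prop)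
  obtain ⟨V, hV, hVm⟩ := hdense.exists_mem_open hopen ⟨⟨U, hU⟩, by simp [hUs, hε]⟩
  refine ⟨V * star U, mul_mem V.2 (Unitary.star_mem hU), hVm, ?_⟩
  rw [mul_assoc, hUs', mul_one]
  intro k _ hk σ τ hσ hτ
  exact Set.mem_iInter.1 hV ⟨⟨k, Nat.lt_succ_of_le hk⟩, ⟨σ, hσ⟩, ⟨τ, hτ⟩⟩
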